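/- arXiv:2405.07961 — 2 statements merged into one kernel-verified Lean document; each statement's English description precedes it below -/
import Mathlib

section
/- If u ∈ ℝ^V satisfies (L(σ)u)|_{Ω⁻} = 0, then 𝒮(γ₁⁻u) − 𝒟⁻(γ₀u) = u·𝟙_{Ω⁻}, where 𝟙_X denotes the indicator vector of X ⊆ V and the product is componentwise. -/
open Matrix BigOperators

noncomputable section

variable {V : Type*} [Fintype V] [DecidableEq V]

/-- Weighted graph Laplacian of a symmetric weight function. -/
def lap (σ : V → V → ℝ) : Matrix V V ℝ :=
  Matrix.of fun x y => if x = y then ∑ z, σ x z else -σ x y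

/-- Restriction matrix `R_X : ℝ^V → ℝ^X`. -/
def restr (X : Finset V) : Matrix {x // x ∈ X} V ℝ :=
  Matrix.of fun i j => if (i : V) = j then 1 else 0

/-- Green function `G = R_{V°}ᵀ (L[V°,V°])⁻¹ R_{V°}` with `V° = Bᶜ`. -/
def green (B : Finset V) (σ : V → V → ℝ) : Matrix V V ℝ :=
  (restr Bᶜ)ᵀ * (restr Bᶜ * lap σ * (restr Bᶜ)ᵀ)⁻¹ * restr Bᶜ

/-- Dirichlet trace operator `γ₀ = R_{∂Ω}`. -/
def gamma0 (dO : Finset V) : Matrix {x // x ∈ dO} V ℝ := restr dO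

/-- Exterior Neumann trace operator `γ₁⁺ = -R_{∂Ω} L(σ⁺)`. -/
def gamma1p (dO : Finset V) (σp : V → V → ℝ) : Matrix {x // x ∈ dO} V ℝ :=
  -(restr dO * lap σp)

/-- Interior Neumann trace operator `γ₁⁻ = R_{∂Ω} L(σ⁻)`. -/
def gamma1m (dO : Finset V) (σm : V → V → ℝ) : Matrix {x // x ∈ dO} V ℝ :=
  restr dO * lap σm

/-- Single layer potential `𝒮 = G γ₀ᵀ`. -/
def slp (B dO : Finset V) (σ : V → V → ℝ) : Matrix V {x // x ∈ dO} ℝ :=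
  green B σ * (gamma0 dO)ᵀ

/-- Exterior double layer potential `𝒟⁺ = G (γ₁⁺)ᵀ`. -/
def dlpP (B dO : Finset V) (σ σp : V → V → ℝ) : Matrix V {x // x ∈ dO} ℝ :=
  green B σ * (gamma1p dO σp)ᵀ

/-- Interior double layer potential `𝒟⁻ = G (γ₁⁻)ᵀ`. -/
def dlpM (B dO : Finset V) (σ σm : V → V → ℝ) : Matrix V {x // x ∈ dO} ℝ :=
  green B σ * (gamma1m dO σm)ᵀ

/-- Single layer boundary operator `S = γ₀ 𝒮`. -/
def Sop (B dO : Finset V) (σ : V → V → ℝ) : Matrix {x // x ∈ dO} {x // x ∈ dO} ℝ :=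
  gamma0 dO * slp B dO σ

/-- Double layer boundary operator `D = ½ γ₀ (𝒟⁺ + 𝒟⁻)`. -/
def Dop (B dO : Finset V) (σ σp σm : V → V → ℝ) : Matrix {x // x ∈ dO} {x // x ∈ dO} ℝ :=
  (1/2 : ℝ) • (gamma0 dO * (dlpP B dO σ σp + dlpM B dO σ σm))

/-- Adjoint double layer (Neumann–Poincaré) operator `D' = ½ (γ₁⁺ + γ₁⁻) 𝒮`. -/
def Dadj (B dO : Finset V) (σ σp σm : V → V → ℝ) : Matrix {x // x ∈ dO} {x // x ∈ dO} ℝ :=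
  (1/2 : ℝ) • ((gamma1p dO σp + gamma1m dO σm) * slp B dO σ)

/-- Hypersingular operator `H = -γ₁⁺ 𝒟⁻`. -/
def Hop (B dO : Finset V) (σ σp σm : V → V → ℝ) : Matrix {x // x ∈ dO} {x // x ∈ dO} ℝ :=
  -(gamma1p dO σp * dlpM B dO σ σm)

/-- Indicator vector of a node subset. -/
def ind (X : Finset V) : V → ℝ := fun x => if x ∈ X then 1 else 0

/-- The subgraph with node set `A` and edges `{x,y}` with `w x y > 0` is connected. -/
def connOn (A : Finset V) (w : V → V → ℝ) : Prop :=
  ∀ x ∈ A, ∀ y ∈ A, Relation.ReflTransGen (fun a b => a ∈ A ∧ b ∈ A ∧ 0 < w a b) x y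

theorem lap_transpose {V : Type*} [Fintype V] [DecidableEq V] {σ : V → V → ℝ}
    (hσ : ∀ x y, σ x y = σ y x) : (lap σ)ᵀ = lap σ := by
  ext x y
  by_cases h : x = y
  · subst h; rfl
  · simp [lap, h, Ne.symm h, hσ x y]

theorem restr_transpose_mulVec_restr_mulVec {V : Type*} [Fintype V] [DecidableEq V]
    (X : Finset V) (v : V → ℝ) : (restr X)ᵀ *ᵥ (restr X *ᵥ v) = ind X * v := by
  have hR : restr X *ᵥ v = fun i : {x // x ∈ X} => v (i : V) := by
    funext i
    simp [restr, mulVec, dotProduct]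
  ext x
  rw [hR]
  by_cases hx : x ∈ X
  · rw [mulVec, dotProduct, Finset.sum_eq_single ⟨x, hx⟩]
    · simp [restr, ind, hx]
    · intro i _ hi
      have : (i : V) ≠ x := fun h => hi (Subtype.ext h)
      simp [restr, this]
    · simp
  · rw [mulVec, dotProduct, Finset.sum_eq_zero]
    · simp [ind, hx]
    · intro i _
      have : (i : V) ≠ x := fun h => hx (h ▸ i.2)
      simp [restr, this]

theorem lap_mulVec_apply {V : Type*} [Fintype V] [DecidableEq V] {σ : V → V → ℝ}
    (hσ : ∀ x, σ x x = 0) (v : V → ℝ) (x : V) :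
    (lap σ *ᵥ v) x = ∑ y, σ x y * (v x - v y) := by
  have h : ∀ y, lap σ x y * v y = (if x = y then (∑ z, σ x z) * v y else 0) - σ x y * v y := by
    intro y
    by_cases hxy : x = y
    · subst hxy; simp [lap, hσ]
    · simp [lap, hxy]
  simp only [mulVec, dotProduct, h, mul_sub, Finset.sum_sub_distrib, Finset.sum_mul]
  simp

theorem green_mulVec_lap_mulVec {V : Type*} [Fintype V] [DecidableEq V] {B : Finset V}
    {σ : V → V → ℝ} (hpd : (restr Bᶜ * lap σ * (restr Bᶜ)ᵀ).PosDef) {w : V → ℝ}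
    (hw : ind Bᶜ * w = w) : green B σ *ᵥ (lap σ *ᵥ w) = w := by
  have hdet : IsUnit (restr Bᶜ * lap σ * (restr Bᶜ)ᵀ).det := hpd.det_pos.ne'.isUnit
  have hRw : (restr Bᶜ)ᵀ *ᵥ (restr Bᶜ *ᵥ w) = w := by
    rw [restr_transpose_mulVec_restr_mulVec, hw]
  calc green B σ *ᵥ (lap σ *ᵥ w)
      = green B σ *ᵥ (lap σ *ᵥ ((restr Bᶜ)ᵀ *ᵥ (restr Bᶜ *ᵥ w))) := by rw [hRw]
    _ = (restr Bᶜ)ᵀ *ᵥ (((restr Bᶜ * lap σ * (restr Bᶜ)ᵀ)⁻¹ *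
          (restr Bᶜ * lap σ * (restr Bᶜ)ᵀ)) *ᵥ (restr Bᶜ *ᵥ w)) := by
        simp only [green, mulVec_mulVec, Matrix.mul_assoc]
    _ = w := by rw [nonsing_inv_mul _ hdet, one_mulVec, hRw]

theorem stmt_2
    {V : Type*} [Fintype V] [DecidableEq V]
    (B Op dO Om : Finset V)
    (hBne : B.Nonempty) (hOpne : Op.Nonempty) (hdOne : dO.Nonempty) (hOmne : Om.Nonempty)
    (hd1 : Disjoint B Op) (hd2 : Disjoint B dO) (hd3 : Disjoint B Om)
    (hd4 : Disjoint Op dO) (hd5 : Disjoint Op Om) (hd6 : Disjoint dO Om)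
    (hcover : B ∪ Op ∪ dO ∪ Om = Finset.univ)
    (σ σp σm : V → V → ℝ)
    (hσsymm : ∀ x y, σ x y = σ y x) (hσdiag : ∀ x, σ x x = 0)
    (hσnn : ∀ x y, 0 ≤ σ x y)
    (hsepBdO : ∀ x ∈ B, ∀ y ∈ dO, σ x y = 0)
    (hsepBOm : ∀ x ∈ B, ∀ y ∈ Om, σ x y = 0)
    (hsepOpOm : ∀ x ∈ Op, ∀ y ∈ Om, σ x y = 0)
    (hσpsymm : ∀ x y, σp x y = σp y x) (hσpdiag : ∀ x, σp x x = 0)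
    (hσmsymm : ∀ x y, σm x y = σm y x) (hσmdiag : ∀ x, σm x x = 0)
    (hσpnn : ∀ x y, 0 ≤ σp x y) (hσmnn : ∀ x y, 0 ≤ σm x y)
    (hsum : ∀ x y, σp x y + σm x y = σ x y)
    (hp1 : ∀ x y, x ∈ B ∪ Op ∨ y ∈ B ∪ Op → σp x y = σ x y)
    (hm1 : ∀ x y, x ∈ Om ∨ y ∈ Om → σm x y = σ x y)
    (hpd : (restr Bᶜ * lap σ * (restr Bᶜ)ᵀ).PosDef) :
    ∀ u : V → ℝ, (∀ x ∈ Om, (lap σ *ᵥ u) x = 0) →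
      slp B dO σ *ᵥ (gamma1m dO σm *ᵥ u) - dlpM B dO σ σm *ᵥ (gamma0 dO *ᵥ u)
        = u * ind Om := by
  intro u hu
  have hB : ind Bᶜ * (u * ind Om) = u * ind Om := by
    ext x
    by_cases hx : x ∈ Om
    · have : x ∉ B := fun h => Finset.disjoint_left.mp hd3 h hx
      simp [ind, hx, this]
    · simp [ind, hx]
  have hm0 : ∀ x y, x ∈ B ∪ Op ∨ y ∈ B ∪ Op → σm x y = 0 := fun x y h => by
    linarith [hp1 x y h, hsum x y]
  have key : ind dO * (lap σm *ᵥ u) - lap σm *ᵥ (ind dO * u) = lap σ *ᵥ (u * ind Om) := by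
    ext x
    have hxc : x ∈ B ∪ Op ∪ dO ∪ Om := hcover ▸ Finset.mem_univ x
    have hw : ∀ y, σm x y * (ind dO y + ind Om y) = σm x y := by
      intro y
      have hyc : y ∈ B ∪ Op ∪ dO ∪ Om := hcover ▸ Finset.mem_univ y
      rw [Finset.mem_union, Finset.mem_union] at hyc
      rcases hyc with (hy | hy) | hy
      · simp [hm0 x y (Or.inr hy)]
      · simp [ind, hy, Finset.disjoint_left.mp hd6 hy]
      · simp [ind, hy, Finset.disjoint_right.mp hd6 hy]
    have hσw : ∀ y, σ x y * ((u * ind Om) x - (u * ind Om) y) =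
        σm x y * ((u * ind Om) x - (u * ind Om) y) := by
      intro y
      by_cases h : x ∈ Om ∨ y ∈ Om
      · rw [hm1 x y h]
      · rw [not_or] at h
        simp [ind, h.1, h.2]
    simp only [Pi.sub_apply, Pi.mul_apply (ind dO) (lap σm *ᵥ u)]
    rw [lap_mulVec_apply hσmdiag, lap_mulVec_apply hσmdiag, lap_mulVec_apply hσdiag,
      Finset.sum_congr rfl fun y _ => hσw y]
    rw [Finset.mem_union, Finset.mem_union] at hxc
    have hcomb : ∑ y, σm x y * ((ind dO * u) x - (ind dO * u) y) +
        ∑ y, σm x y * ((u * ind Om) x - (u * ind Om) y) =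
        ∑ y, σm x y * (u x - u y) := by
      rw [← Finset.sum_add_distrib]
      refine Finset.sum_congr rfl fun y _ => ?_
      rcases hxc with (hx | hx) | hx
      · simp [hm0 x y (Or.inl hx)]
      · have h1 : ind dO x = 1 := if_pos hx
        have h2 : ind Om x = 0 := if_neg (Finset.disjoint_left.mp hd6 hx)
        simp only [Pi.mul_apply, h1, h2]
        linear_combination (-u y) * hw y
      · have h1 : ind dO x = 0 := if_neg (Finset.disjoint_right.mp hd6 hx)
        have h2 : ind Om x = 1 := if_pos hx
        simp only [Pi.mul_apply, h1, h2]
        linear_combination (-u y) * hw y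
    have hflux : ind dO x * ∑ y, σm x y * (u x - u y) = ∑ y, σm x y * (u x - u y) := by
      rcases hxc with (hx | hx) | hx
      · simp [hm0 x _ (Or.inl hx)]
      · simp [ind, hx]
      · have h := hu x hx
        rw [lap_mulVec_apply hσdiag] at h
        simp only [hm1 x _ (Or.inl hx), h, mul_zero]
    linarith
  calc slp B dO σ *ᵥ (gamma1m dO σm *ᵥ u) - dlpM B dO σ σm *ᵥ (gamma0 dO *ᵥ u)
      = green B σ *ᵥ ((restr dO)ᵀ *ᵥ (restr dO *ᵥ (lap σm *ᵥ u)) -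
          lap σm *ᵥ ((restr dO)ᵀ *ᵥ (restr dO *ᵥ u))) := by
        rw [mulVec_sub]
        simp only [slp, dlpM, gamma0, gamma1m, transpose_mul, lap_transpose hσmsymm,
          mulVec_mulVec, Matrix.mul_assoc]
    _ = green B σ *ᵥ (lap σ *ᵥ (u * ind Om)) := by
        simp only [restr_transpose_mulVec_restr_mulVec, key]
    _ = u * ind Om := green_mulVec_lap_mulVec hpd hB
end
end

section
/- For every f ∈ ℝ^{∂Ω}, the vector v = 𝒮 S⁻¹ f solves the exterior Dirichlet problem: (L(σ⁺)v)|_{Ω⁺} = 0, v|_{∂Ω} = f and v|_B = 0. Moreover the solution is unique on B ∪ Ω⁺ ∪ ∂Ω: any v' ∈ ℝ^V with (L(σ⁺)v')|_{Ω⁺} = 0, v'|_{∂Ω} = f and v'|_B = 0 satisfies v'|_{B ∪ Ω⁺ ∪ ∂Ω} = v|_{B ∪ Ω⁺ ∪ ∂Ω}. -/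
open Matrix BigOperators

noncomputable section

variable {V : Type*} [Fintype V] [DecidableEq V]

theorem restr_mulVec (X : Finset V) (u : V → ℝ) (i : {x // x ∈ X}) :
    (restr X *ᵥ u) i = u i := by
  simp [restr, mulVec, dotProduct]

theorem restr_transpose_mulVec_of_mem {V : Type*} [DecidableEq V] {X : Finset V}
    (a : {x // x ∈ X} → ℝ) {x : V} (hx : x ∈ X) : ((restr X)ᵀ *ᵥ a) x = a ⟨x, hx⟩ := by
  have h : ∀ i : {x // x ∈ X}, ((i : V) = x) = (i = ⟨x, hx⟩) := fun i => by
    rw [Subtype.ext_iff]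
  simp [restr, mulVec, dotProduct, h]

theorem restr_transpose_mulVec_of_notMem {V : Type*} [DecidableEq V] {X : Finset V}
    (a : {x // x ∈ X} → ℝ) {x : V} (hx : x ∉ X) : ((restr X)ᵀ *ᵥ a) x = 0 := by
  refine Finset.sum_eq_zero fun i _ => ?_
  have : (i : V) ≠ x := fun h => hx (h ▸ i.2)
  simp [restr, this]

theorem restr_transpose_mulVec_restr_mulVec_s12 {X : Finset V} {u : V → ℝ}
    (hu : ∀ x ∉ X, u x = 0) : (restr X)ᵀ *ᵥ (restr X *ᵥ u) = u := by
  ext x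
  by_cases hx : x ∈ X
  · rw [restr_transpose_mulVec_of_mem _ hx, restr_mulVec]
  · rw [restr_transpose_mulVec_of_notMem _ hx, hu x hx]

theorem green_mulVec_eq_zero {B : Finset V} (σ : V → V → ℝ) (g : V → ℝ) {x : V} (hx : x ∈ B) :
    (green B σ *ᵥ g) x = 0 := by
  rw [green, Matrix.mul_assoc, ← mulVec_mulVec]
  exact restr_transpose_mulVec_of_notMem _ (by simpa using hx)

/-- The Green function inverts the Laplacian off `B`. -/
theorem lap_mulVec_green_mulVec {B : Finset V} {σ : V → V → ℝ}
    (hpd : (restr Bᶜ * lap σ * (restr Bᶜ)ᵀ).PosDef) (g : V → ℝ) {x : V} (hx : x ∉ B) :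
    (lap σ *ᵥ (green B σ *ᵥ g)) x = g x := by
  have hx' : x ∈ Bᶜ := by simpa using hx
  have key : restr Bᶜ *ᵥ (lap σ *ᵥ (green B σ *ᵥ g)) = restr Bᶜ *ᵥ g := by
    have hinv := mul_nonsing_inv _ ((isUnit_iff_isUnit_det _).mp hpd.isUnit)
    rw [mulVec_mulVec, mulVec_mulVec, green, ← Matrix.mul_assoc, ← Matrix.mul_assoc,
      hinv, Matrix.one_mul]
  simpa only [restr_mulVec] using congrFun key ⟨x, hx'⟩

theorem posDef_Sop {B dO : Finset V} {σ : V → V → ℝ} (hd : Disjoint B dO)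
    (hpd : (restr Bᶜ * lap σ * (restr Bᶜ)ᵀ).PosDef) : (Sop B dO σ).PosDef := by
  have hinj : Function.Injective (restr Bᶜ * (restr dO)ᵀ).mulVec := by
    intro a b hab
    ext ⟨x, hx⟩
    have hx' : x ∈ Bᶜ := by simpa using Finset.disjoint_right.mp hd hx
    have := congrFun hab ⟨x, hx'⟩
    simpa only [← mulVec_mulVec, restr_mulVec, restr_transpose_mulVec_of_mem _ hx] using this
  have h := hpd.inv.conjTranspose_mul_mul_same hinj
  rw [conjTranspose_eq_transpose_of_trivial, transpose_mul, transpose_transpose] at h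
  simpa only [Sop, slp, green, gamma0, Matrix.mul_assoc] using h

/-- A vector supported off `B` and harmonic on its support vanishes. -/
theorem eq_zero_of_lap_mulVec_eq_zero {B : Finset V} {σ : V → V → ℝ}
    (hpd : (restr Bᶜ * lap σ * (restr Bᶜ)ᵀ).PosDef) {u : V → ℝ} (hB : ∀ x ∈ B, u x = 0)
    (hu : ∀ x, u x ≠ 0 → (lap σ *ᵥ u) x = 0) : u = 0 := by
  have hext : (restr Bᶜ)ᵀ *ᵥ (restr Bᶜ *ᵥ u) = u :=
    restr_transpose_mulVec_restr_mulVec_s12 fun x hx => hB x (by simpa using hx)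
  have hzero : restr Bᶜ *ᵥ u = 0 := by
    by_contra hne
    refine (hpd.dotProduct_mulVec_pos hne).ne' ?_
    rw [← mulVec_mulVec, hext, ← mulVec_mulVec]
    refine Finset.sum_eq_zero fun i _ => ?_
    simp only [Pi.star_apply, star_trivial, restr_mulVec]
    by_cases h : u i = 0
    · simp [h]
    · simp [hu _ h]
  rw [← hext, hzero, mulVec_zero]

theorem lap_mulVec_congr {σ τ : V → V → ℝ} {x : V} (h : ∀ y, σ x y = τ x y) (u : V → ℝ) :
    (lap σ *ᵥ u) x = (lap τ *ᵥ u) x := by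
  simp [lap, mulVec, dotProduct, h]

/-- The Laplacian at `x` sees only `x` and its neighbours. -/
theorem lap_mulVec_congr_right {σ : V → V → ℝ} {u w : V → ℝ} {x : V} (hx : u x = w x)
    (h : ∀ y, σ x y ≠ 0 → u y = w y) : (lap σ *ᵥ u) x = (lap σ *ᵥ w) x := by
  refine Finset.sum_congr rfl fun y _ => ?_
  by_cases hxy : x = y
  · subst hxy
    rw [hx]
  · by_cases hσ : σ x y = 0
    · simp [lap, hxy, hσ]
    · rw [h y hσ]

theorem stmt_12
    {V : Type*} [Fintype V] [DecidableEq V]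
    (B Op dO Om : Finset V)
    (hBne : B.Nonempty) (hOpne : Op.Nonempty) (hdOne : dO.Nonempty) (hOmne : Om.Nonempty)
    (hd1 : Disjoint B Op) (hd2 : Disjoint B dO) (hd3 : Disjoint B Om)
    (hd4 : Disjoint Op dO) (hd5 : Disjoint Op Om) (hd6 : Disjoint dO Om)
    (hcover : B ∪ Op ∪ dO ∪ Om = Finset.univ)
    (σ σp σm : V → V → ℝ)
    (hσsymm : ∀ x y, σ x y = σ y x) (hσdiag : ∀ x, σ x x = 0)
    (hσnn : ∀ x y, 0 ≤ σ x y)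
    (hsepBdO : ∀ x ∈ B, ∀ y ∈ dO, σ x y = 0)
    (hsepBOm : ∀ x ∈ B, ∀ y ∈ Om, σ x y = 0)
    (hsepOpOm : ∀ x ∈ Op, ∀ y ∈ Om, σ x y = 0)
    (hσpsymm : ∀ x y, σp x y = σp y x) (hσpdiag : ∀ x, σp x x = 0)
    (hσmsymm : ∀ x y, σm x y = σm y x) (hσmdiag : ∀ x, σm x x = 0)
    (hσpnn : ∀ x y, 0 ≤ σp x y) (hσmnn : ∀ x y, 0 ≤ σm x y)
    (hsum : ∀ x y, σp x y + σm x y = σ x y)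
    (hp1 : ∀ x y, x ∈ B ∪ Op ∨ y ∈ B ∪ Op → σp x y = σ x y)
    (hm1 : ∀ x y, x ∈ Om ∨ y ∈ Om → σm x y = σ x y)
    (hpd : (restr Bᶜ * lap σ * (restr Bᶜ)ᵀ).PosDef) :
    ∀ f : {x // x ∈ dO} → ℝ, ∀ v : V → ℝ,
      v = slp B dO σ *ᵥ ((Sop B dO σ)⁻¹ *ᵥ f) →
      ((∀ x ∈ Op, (lap σp *ᵥ v) x = 0)
      ∧ gamma0 dO *ᵥ v = f
      ∧ (∀ x ∈ B, v x = 0)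
      ∧ ∀ v' : V → ℝ, (∀ x ∈ Op, (lap σp *ᵥ v') x = 0) → gamma0 dO *ᵥ v' = f →
          (∀ x ∈ B, v' x = 0) →
          ∀ x ∈ B ∪ Op ∪ dO, v' x = v x) := by
  intro f v hv
  have hlap : ∀ x ∈ Op, ∀ u : V → ℝ, (lap σp *ᵥ u) x = (lap σ *ᵥ u) x := fun x hx u =>
    lap_mulVec_congr (fun y => hp1 x y (Or.inl (Finset.mem_union_right _ hx))) u
  have hvG : v = green B σ *ᵥ ((restr dO)ᵀ *ᵥ ((Sop B dO σ)⁻¹ *ᵥ f)) := by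
    rw [hv, slp, gamma0, ← mulVec_mulVec]
  have hharm : ∀ x ∈ Op, (lap σp *ᵥ v) x = 0 := by
    intro x hx
    rw [hlap x hx, hvG, lap_mulVec_green_mulVec hpd _ (Finset.disjoint_right.mp hd1 hx)]
    exact restr_transpose_mulVec_of_notMem _ (Finset.disjoint_left.mp hd4 hx)
  have htrace : gamma0 dO *ᵥ v = f := by
    have hS := mul_nonsing_inv _ ((isUnit_iff_isUnit_det _).mp (posDef_Sop hd2 hpd).isUnit)
    rw [hv, mulVec_mulVec, ← Sop, mulVec_mulVec, hS, one_mulVec]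
  have hvB : ∀ x ∈ B, v x = 0 := fun x hx => by rw [hvG, green_mulVec_eq_zero σ _ hx]
  refine ⟨hharm, htrace, hvB, fun v' hharm' htrace' hvB' => ?_⟩
  have hagreeB : ∀ x ∈ B, v' x = v x := fun x hx => by rw [hvB x hx, hvB' x hx]
  have hagreedO : ∀ x ∈ dO, v' x = v x := fun x hx => by
    simpa only [gamma0, restr_mulVec] using congrFun (htrace'.trans htrace.symm) ⟨x, hx⟩
  have hzero : (fun x => if x ∈ Op then (v' - v) x else 0) = 0 := by
    refine eq_zero_of_lap_mulVec_eq_zero hpd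
      (fun x hx => if_neg (Finset.disjoint_left.mp hd1 hx)) fun x hx => ?_
    have hxOp : x ∈ Op := by
      by_contra h
      exact hx (if_neg h)
    rw [lap_mulVec_congr_right (w := v' - v) (if_pos hxOp), ← hlap x hxOp, mulVec_sub,
      Pi.sub_apply, hharm x hxOp, hharm' x hxOp, sub_zero]
    intro y hy
    have hycover : y ∈ B ∪ Op ∪ dO ∪ Om := hcover ▸ Finset.mem_univ y
    simp only [Finset.mem_union] at hycover
    split_ifs with hyOp
    · rfl
    · rcases hycover with ((h | h) | h) | h
      · simp [hagreeB y h]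
      · exact absurd h hyOp
      · simp [hagreedO y h]
      · exact absurd (hsepOpOm x hxOp y h) hy
  intro x hx
  simp only [Finset.mem_union] at hx
  rcases hx with (h | h) | h
  · exact hagreeB x h
  · exact sub_eq_zero.mp (by simpa [h] using congrFun hzero x)
  · exact hagreedO x h
end
end
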